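/- Let γ be a centered Gaussian measure on a separable Banach space X with Cameron–Martin space H, and let p ∈ (1,∞) with conjugate exponent p'. For f ∈ C_b(X), t > 0, x ∈ X: ‖∇_H T(t)f(x)‖_H ≤ (c_{p'} e^{-t}/√(1-e^{-2t})) (T(t)(|f|^p)(x))^{1/p}, where c_{p'} is the p'-th absolute moment constant of N(0,1). Consequently ∫_X ‖∇_H T(t)f‖_H^p dγ ≤ (c_{p'} e^{-t}/√(1-e^{-2t}))^p ∫_X |f|^p dγ. -/

import Mathlib

open MeasureTheory ProbabilityTheory
open scoped NNReal RealInnerProductSpace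

/-- A centered Gaussian measure is invariant under `(x, y) ↦ a x + b y` when `a² + b² = 1`. -/
lemma map_smul_add_smul_of_centered_gaussian {X : Type*} [NormedAddCommGroup X] [NormedSpace ℝ X]
    [CompleteSpace X] [SecondCountableTopology X] [MeasurableSpace X] [BorelSpace X]
    (γ : Measure X) [IsProbabilityMeasure γ]
    (hγ : ∀ L : X →L[ℝ] ℝ, ∃ v : ℝ≥0, γ.map L = gaussianReal 0 v)
    {a b : ℝ} (hab : a ^ 2 + b ^ 2 = 1) :
    (γ.prod γ).map (fun z : X × X ↦ a • z.1 + b • z.2) = γ := by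
  let Φ : X × X →L[ℝ] X :=
    a • ContinuousLinearMap.fst ℝ X X + b • ContinuousLinearMap.snd ℝ X X
  have hΦ : (fun z : X × X ↦ a • z.1 + b • z.2) = Φ := by ext z; simp [Φ]
  rw [hΦ]
  have : IsProbabilityMeasure ((γ.prod γ).map Φ) :=
    Measure.isProbabilityMeasure_map (by fun_prop)
  refine Measure.ext_of_charFunDual (funext fun L ↦ ?_)
  obtain ⟨v, hv⟩ := hγ L
  have hinl : (L.comp Φ).comp (.inl ℝ X X) = a • L := by ext x; simp [Φ]
  have hinr : (L.comp Φ).comp (.inr ℝ X X) = b • L := by ext x; simp [Φ]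
  have hone : charFunDual γ L = charFunDual γ ((1 : ℝ) • L) := by rw [one_smul]
  rw [charFunDual_map, charFunDual_prod, hinl, hinr, hone, ← charFun_map_eq_charFunDual_smul,
    ← charFun_map_eq_charFunDual_smul, ← charFun_map_eq_charFunDual_smul, hv,
    charFun_gaussianReal, charFun_gaussianReal, charFun_gaussianReal, ← Complex.exp_add]
  congr 1
  have habC : (a : ℂ) ^ 2 + (b : ℂ) ^ 2 = 1 := by exact_mod_cast hab
  push_cast
  linear_combination (-(v : ℂ) / 2) * habC

/-- Absolute moments of centered real Gaussian measures scale like powers of the standard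
deviation. -/
lemma integral_abs_rpow_gaussianReal (σ : ℝ≥0) (q : ℝ) :
    ∫ ξ, |ξ| ^ q ∂(gaussianReal 0 (σ ^ 2)) = (σ : ℝ) ^ q * ∫ ξ, |ξ| ^ q ∂(gaussianReal 0 1) := by
  have hmap : (gaussianReal 0 1).map ((σ : ℝ) * ·) = gaussianReal 0 (σ ^ 2) := by
    rw [gaussianReal_map_const_mul]
    congr 1
    · simp
    · ext; simp
  rw [← hmap, integral_map (by fun_prop)
    (by fun_prop : Measurable fun ξ : ℝ ↦ |ξ| ^ q).aestronglyMeasurable, ← integral_const_mul]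
  refine integral_congr_ae (.of_forall fun ξ ↦ ?_)
  simp only [abs_mul, NNReal.abs_eq]
  exact Real.mul_rpow σ.coe_nonneg (abs_nonneg ξ)

/-- Hölder's inequality against a centered Gaussian random variable. -/
lemma integral_mul_le_of_map_eq_gaussianReal {X : Type*} [MeasurableSpace X] {γ : Measure X}
    [IsProbabilityMeasure γ] {p q : ℝ} (hpq : p.HolderConjugate q) {φ g : X → ℝ}
    (hφ : MemLp φ (ENNReal.ofReal p) γ) {σ : ℝ≥0} (hg : γ.map g = gaussianReal 0 (σ ^ 2)) :
    ∫ y, φ y * g y ∂γ ≤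
      σ * ((∫ ξ, |ξ| ^ q ∂(gaussianReal 0 1)) ^ (1 / q) * (∫ y, |φ y| ^ p ∂γ) ^ (1 / p)) := by
  have hgm : AEMeasurable g γ := by
    refine AEMeasurable.of_map_ne_zero ?_
    rw [hg]
    exact IsProbabilityMeasure.ne_zero _
  have hgLp : MemLp g (ENNReal.ofReal q) γ := by
    have hid : MemLp id (ENNReal.ofReal q) (γ.map g) := by
      rw [hg]
      exact memLp_id_gaussianReal' _ ENNReal.ofReal_ne_top
    exact hid.comp_of_map hgm
  have hmom : ∫ y, |g y| ^ q ∂γ = (σ : ℝ) ^ q * ∫ ξ, |ξ| ^ q ∂(gaussianReal 0 1) := by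
    rw [← integral_abs_rpow_gaussianReal, ← hg,
      integral_map hgm
        (by fun_prop : Measurable fun ξ : ℝ ↦ |ξ| ^ q).aestronglyMeasurable]
  have hint : 0 ≤ ∫ ξ, |ξ| ^ q ∂(gaussianReal 0 1) :=
    integral_nonneg fun ξ ↦ Real.rpow_nonneg (abs_nonneg ξ) q
  calc ∫ y, φ y * g y ∂γ
      ≤ ∫ y, ‖φ y * g y‖ ∂γ := (Real.le_norm_self _).trans (norm_integral_le_integral_norm _)
    _ = ∫ y, ‖φ y‖ * ‖g y‖ ∂γ := by simp_rw [norm_mul]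
    _ ≤ (∫ y, ‖φ y‖ ^ p ∂γ) ^ (1 / p) * (∫ y, ‖g y‖ ^ q ∂γ) ^ (1 / q) :=
        integral_mul_norm_le_Lp_mul_Lq hpq hφ hgLp
    _ = _ := by
        simp_rw [Real.norm_eq_abs]
        rw [hmom, Real.mul_rpow (Real.rpow_nonneg σ.coe_nonneg q) hint, ← Real.rpow_mul σ.coe_nonneg,
          mul_one_div_cancel hpq.symm.ne_zero, Real.rpow_one]
        ring

/-- The Mehler average preserves integrability and integrals with respect to `γ`. -/
lemma integrable_mehler_and_integral_mehler_eq {X : Type*} [NormedAddCommGroup X] [NormedSpace ℝ X]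
    [CompleteSpace X] [SecondCountableTopology X] [MeasurableSpace X] [BorelSpace X]
    (γ : Measure X) [IsProbabilityMeasure γ]
    (hγ : ∀ L : X →L[ℝ] ℝ, ∃ v : ℝ≥0, γ.map L = gaussianReal 0 v)
    {a b : ℝ} (hab : a ^ 2 + b ^ 2 = 1) {F : X → ℝ} (hF : Integrable F γ) :
    Integrable (fun x ↦ ∫ y, F (a • x + b • y) ∂γ) γ ∧
      ∫ x, ∫ y, F (a • x + b • y) ∂γ ∂γ = ∫ x, F x ∂γ := by
  have hmap := map_smul_add_smul_of_centered_gaussian γ hγ hab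
  have hm : AEMeasurable (fun z : X × X ↦ a • z.1 + b • z.2) (γ.prod γ) := by fun_prop
  rw [← hmap] at hF
  have hprod : Integrable (fun z : X × X ↦ F (a • z.1 + b • z.2)) (γ.prod γ) :=
    hF.comp_aemeasurable hm
  refine ⟨hprod.integral_prod_left, ?_⟩
  rw [integral_integral hprod, ← integral_map hm hF.aestronglyMeasurable, hmap]

/-- Pointwise `L^p` gradient estimate for the Mehler semigroup:
`‖∇_H T(t)f(x)‖_H ≤ c_{p'} e^{-t}/√(1-e^{-2t}) (T(t)|f|^p(x))^{1/p}`, and the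
resulting integral estimate with respect to the invariant measure `γ`. -/
theorem stmt12 {X H : Type*} [NormedAddCommGroup X] [NormedSpace ℝ X] [CompleteSpace X]
    [TopologicalSpace.SeparableSpace X] [MeasurableSpace X] [BorelSpace X]
    [NormedAddCommGroup H] [InnerProductSpace ℝ H] [CompleteSpace H]
    (γ : Measure X) [IsProbabilityMeasure γ]
    (hγ : ∀ L : X →L[ℝ] ℝ, ∃ v : ℝ≥0, γ.map L = gaussianReal 0 v)
    (ι : H →L[ℝ] X) (hι : Function.Injective ι)
    (hat : H → X → ℝ)
    (hhatadd : ∀ h k : H, ∀ y : X, hat (h + k) y = hat h y + hat k y)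
    (hhatsmul : ∀ (c : ℝ) (h : H) (y : X), hat (c • h) y = c * hat h y)
    (hhatlaw : ∀ h : H, γ.map (hat h) = gaussianReal 0 (‖h‖₊ ^ 2))
    (p : ℝ) (hp : 1 < p)
    (f : BoundedContinuousFunction X ℝ) (t : ℝ) (ht : 0 < t)
    (G : X → H)
    (hG : ∀ (x : X) (h : H), ⟪G x, h⟫ =
      (Real.exp (-t) / Real.sqrt (1 - Real.exp (-2*t))) *
        ∫ y, f (Real.exp (-t) • x + Real.sqrt (1 - Real.exp (-2*t)) • y) * hat h y ∂γ) :
    (∀ x : X, ‖G x‖ ≤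
      ((∫ ξ, |ξ| ^ (p/(p-1)) ∂(gaussianReal 0 1)) ^ ((p-1)/p)) *
        (Real.exp (-t) / Real.sqrt (1 - Real.exp (-2*t))) *
        (∫ y, |f (Real.exp (-t) • x + Real.sqrt (1 - Real.exp (-2*t)) • y)| ^ p ∂γ) ^ (1/p))
    ∧ (∫ x, ‖G x‖ ^ p ∂γ) ≤
        (((∫ ξ, |ξ| ^ (p/(p-1)) ∂(gaussianReal 0 1)) ^ ((p-1)/p)) *
          (Real.exp (-t) / Real.sqrt (1 - Real.exp (-2*t)))) ^ p *
          ∫ x, |f x| ^ p ∂γ := by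
  have : SecondCountableTopology X := UniformSpace.secondCountable_of_separable X
  have hpq : p.HolderConjugate (p / (p - 1)) := Real.HolderConjugate.conjExponent hp
  have hp0 : 0 < p := hpq.pos
  have hinv : 1 / (p / (p - 1)) = (p - 1) / p := one_div_div p (p - 1)
  have hexp : Real.exp (-2 * t) < 1 := Real.exp_lt_one_iff.2 (by linarith)
  have hab : Real.exp (-t) ^ 2 + Real.sqrt (1 - Real.exp (-2 * t)) ^ 2 = 1 := by
    rw [Real.sq_sqrt (by linarith), ← Real.exp_nat_mul]
    ring_nf
  have hb : 0 ≤ Real.sqrt (1 - Real.exp (-2 * t)) := Real.sqrt_nonneg _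
  have ha : 0 ≤ Real.exp (-t) := (Real.exp_pos _).le
  generalize Real.sqrt (1 - Real.exp (-2 * t)) = b at *
  generalize Real.exp (-t) = a at *
  have hF : ∀ {u : X → X}, Continuous u → ∀ r : ENNReal, MemLp (fun y ↦ f (u y)) r γ :=
    fun hu r ↦ MemLp.of_bound (f.continuous.comp hu).aestronglyMeasurable ‖f‖
      (.of_forall fun y ↦ f.norm_coe_le_norm _)
  have hmoment : 0 ≤ ∫ ξ, |ξ| ^ (p / (p - 1)) ∂(gaussianReal 0 1) :=
    integral_nonneg fun ξ ↦ Real.rpow_nonneg (abs_nonneg ξ) _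
  have hmehler : ∀ x, 0 ≤ ∫ y, |f (a • x + b • y)| ^ p ∂γ := fun x ↦
    integral_nonneg fun y ↦ Real.rpow_nonneg (abs_nonneg _) _
  have hpoint : ∀ x : X, ‖G x‖ ≤
      ((∫ ξ, |ξ| ^ (p / (p - 1)) ∂(gaussianReal 0 1)) ^ ((p - 1) / p)) * (a / b) *
        (∫ y, |f (a • x + b • y)| ^ p ∂γ) ^ (1 / p) := by
    intro x
    have hholder := integral_mul_le_of_map_eq_gaussianReal hpq
      (hF (u := fun y ↦ a • x + b • y) (by fun_prop) (ENNReal.ofReal p)) (hhatlaw (G x))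
    rw [hinv, coe_nnnorm] at hholder
    have hsq : ‖G x‖ * ‖G x‖ = a / b * ∫ y, f (a • x + b • y) * hat (G x) y ∂γ := by
      rw [← real_inner_self_eq_norm_mul_norm, hG]
    rcases (norm_nonneg (G x)).eq_or_lt with h0 | h0
    · rw [← h0]
      have := hmehler x
      positivity
    · refine le_of_mul_le_mul_left ?_ h0
      rw [hsq]
      refine (mul_le_mul_of_nonneg_left hholder (by positivity)).trans_eq ?_
      ring
  refine ⟨hpoint, ?_⟩
  have hfp : Integrable (fun x ↦ |f x| ^ p) γ := by
    have := (hF continuous_id (ENNReal.ofReal p)).integrable_norm_rpow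
      (by simpa using hp0) ENNReal.ofReal_ne_top
    simpa [ENNReal.toReal_ofReal hp0.le] using this
  obtain ⟨hint, heq⟩ := integrable_mehler_and_integral_mehler_eq γ hγ hab hfp
  rw [← heq, ← integral_const_mul]
  refine integral_mono_of_nonneg (.of_forall fun x ↦ Real.rpow_nonneg (norm_nonneg _) p)
    (hint.const_mul _) (.of_forall fun x ↦ ?_)
  refine (Real.rpow_le_rpow (norm_nonneg _) (hpoint x) hp0.le).trans_eq ?_
  rw [Real.mul_rpow (by positivity) (Real.rpow_nonneg (hmehler x) _), ← Real.rpow_mul (hmehler x),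
    one_div_mul_cancel hp0.ne', Real.rpow_one]
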